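/- arXiv:2510.14399 — 2 statements merged into one kernel-verified Lean document; each statement's English description precedes it below -/
import Mathlib

section
/- Let n < ω and let α, β be ordinals. If β ∈ B_n(α) and β < α, then ψ_n(β) < ψ_n(α). -/
open Ordinal Set

/-- The Veblen hierarchy: `phi 0` is the strictly increasing enumeration of the
additively principal ordinals (nonzero ordinals closed under addition), and for `α > 0`,
`phi α` is the strictly increasing enumeration of the common fixed points of the
functions `phi δ` for `δ < α`. -/
noncomputable def phi : Ordinal → Ordinal → Ordinal
  | α => Ordinal.enumOrd {β | (α = 0 → β ≠ 0 ∧ ∀ γ < β, ∀ δ < β, γ + δ < β) ∧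
      ∀ δ, δ < α → phi δ β = β}
termination_by α => α
decreasing_by assumption

/-- `Cr 0` is the class of additively principal ordinals (nonzero ordinals `β` such that
`γ + δ < β` for all `γ, δ < β`); for `α > 0`, `Cr α = {β | ∀ δ < α, phi δ β = β}`.
`phi α` is (definitionally) the strictly increasing enumeration of `Cr α`. -/
def Cr (α : Ordinal) : Set Ordinal :=
  {β | (α = 0 → β ≠ 0 ∧ ∀ γ < β, ∀ δ < β, γ + δ < β) ∧ ∀ δ, δ < α → phi δ β = β}

/-- An ordinal is strongly critical if it is nonzero and closed under `(δ, γ) ↦ phi δ γ`. -/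
def StronglyCritical (α : Ordinal) : Prop :=
  α ≠ 0 ∧ ∀ δ < α, ∀ γ < α, phi δ γ < α

/-- `Gamma β` is the `β`-th strongly critical ordinal. -/
noncomputable def Gamma : Ordinal → Ordinal :=
  Ordinal.enumOrd {α | StronglyCritical α}

/-- An ordinal which is (the initial ordinal of) an uncountable regular cardinal. -/
def IsUncountableRegular (o : Ordinal) : Prop :=
  ∃ κ : Cardinal, Cardinal.aleph0 < κ ∧ κ.IsRegular ∧ o = κ.ord

/-- The base sets `B_n^0(α)` (they do not depend on `α`):
`B_0^0(α) = {0} ∪ {Γ_β : β ≤ θ} ∪ {Ω_m : m ≤ ω}` and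
`B_{n+1}^0(α) = {β : β < Ω_n} ∪ {Ω_m : m ≤ ω}`. -/
def Bbase (θ : Ordinal) (Ω : ℕ → Ordinal) (Ωω : Ordinal) : ℕ → Set Ordinal
  | 0 => {0} ∪ {x | ∃ β ≤ θ, x = Gamma β} ∪ {x | (∃ m : ℕ, x = Ω m) ∨ x = Ωω}
  | n + 1 => {β | β < Ω n} ∪ {x | (∃ m : ℕ, x = Ω m) ∨ x = Ωω}

/-- One closure step, producing `B_n^{k+1}(α)` from `S = B_n^k(α)`, where the function `f`
plays the role of `ψ`:
`S ∪ {δ + δ' : δ, δ' ∈ S} ∪ {phi δ δ' : δ, δ' ∈ S} ∪ {f m δ : m < ω, δ ∈ S, δ < α}`. -/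
def Bstep (f : ℕ → Ordinal → Ordinal) (α : Ordinal) (S : Set Ordinal) : Set Ordinal :=
  S ∪ {x | ∃ δ ∈ S, ∃ δ' ∈ S, x = δ + δ'}
    ∪ {x | ∃ δ ∈ S, ∃ δ' ∈ S, x = phi δ δ'}
    ∪ {x | ∃ m : ℕ, ∃ δ ∈ S, δ < α ∧ x = f m δ}

/-- The sets `B_n^k(α)`, where the function `f` plays the role of `ψ`. -/
def Biter (θ : Ordinal) (Ω : ℕ → Ordinal) (Ωω : Ordinal)
    (f : ℕ → Ordinal → Ordinal) (α : Ordinal) (n : ℕ) : ℕ → Set Ordinal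
  | 0 => Bbase θ Ω Ωω n
  | k + 1 => Bstep f α (Biter θ Ω Ωω f α n k)

/-- `psi θ Ω Ωω n α` is the least ordinal not in `B_n(α) = ⋃ k, B_n^k(α)`.  (The values of
`ψ` are only ever used at arguments `δ < α`, so the guard `if δ < α` does not change the
sets `B_n^k(α)`; it only serves to make the recursion on `α` well-founded.) -/
noncomputable def psi (θ : Ordinal) (Ω : ℕ → Ordinal) (Ωω : Ordinal) : ℕ → Ordinal → Ordinal
  | n, α => sInf {β | β ∉ ⋃ k,
      Biter θ Ω Ωω (fun m δ => if _ : δ < α then psi θ Ω Ωω m δ else 0) α n k}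
termination_by n α => α
decreasing_by assumption

/-- The set `B_n(α) = ⋃ k, B_n^k(α)`. -/
noncomputable def Bset (θ : Ordinal) (Ω : ℕ → Ordinal) (Ωω : Ordinal)
    (n : ℕ) (α : Ordinal) : Set Ordinal :=
  ⋃ k, Biter θ Ω Ωω (fun m δ => if _ : δ < α then psi θ Ω Ωω m δ else 0) α n k

section

universe u

variable {θ Ωω : Ordinal.{u}} {Ω : ℕ → Ordinal.{u}} {n : ℕ} {α β : Ordinal.{u}}

theorem small_Bbase (θ : Ordinal.{u}) (Ω : ℕ → Ordinal.{u}) (Ωω : Ordinal.{u}) (n : ℕ) :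
    Small.{u} (Bbase θ Ω Ωω n) := by
  have hΩ : Small.{u} ↥({x | (∃ m : ℕ, x = Ω m) ∨ x = Ωω} : Set Ordinal.{u}) :=
    small_subset (s := range Ω ∪ {Ωω}) (by rintro x (⟨m, rfl⟩ | rfl) <;> simp)
  cases n with
  | zero =>
    have hΓ : Small.{u} ↥({x | ∃ β ≤ θ, x = Gamma β} : Set Ordinal.{u}) :=
      small_subset (s := Gamma '' Iic θ) (by rintro x ⟨β, hβ, rfl⟩; exact ⟨β, hβ, rfl⟩)
    exact small_union _ _
  | succ n =>
    have hI : Small.{u} ↥({β | β < Ω n} : Set Ordinal.{u}) := inferInstanceAs (Small (Iio (Ω n)))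
    exact small_union _ _

theorem small_Bstep (f : ℕ → Ordinal.{u} → Ordinal.{u}) (α : Ordinal.{u}) (S : Set Ordinal.{u})
    [Small.{u} S] : Small.{u} (Bstep f α S) := by
  refine small_subset (s := S ∪ image2 (· + ·) S S ∪ image2 phi S S ∪ ⋃ m, f m '' S) ?_
  rintro x (((h | ⟨δ, hδ, δ', hδ', rfl⟩) | ⟨δ, hδ, δ', hδ', rfl⟩) | ⟨m, δ, hδ, -, rfl⟩)
  · exact .inl (.inl (.inl h))
  · exact .inl (.inl (.inr ⟨δ, hδ, δ', hδ', rfl⟩))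
  · exact .inl (.inr ⟨δ, hδ, δ', hδ', rfl⟩)
  · exact .inr (mem_iUnion.2 ⟨m, δ, hδ, rfl⟩)

theorem small_Biter (θ : Ordinal.{u}) (Ω : ℕ → Ordinal.{u}) (Ωω : Ordinal.{u})
    (f : ℕ → Ordinal.{u} → Ordinal.{u}) (α : Ordinal.{u}) (n k : ℕ) :
    Small.{u} (Biter θ Ω Ωω f α n k) := by
  induction k with
  | zero => exact small_Bbase θ Ω Ωω n
  | succ k ih => exact small_Bstep f α _

theorem small_Bset (θ : Ordinal.{u}) (Ω : ℕ → Ordinal.{u}) (Ωω : Ordinal.{u}) (n : ℕ)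
    (α : Ordinal.{u}) : Small.{u} (Bset θ Ω Ωω n α) :=
  have := small_Biter θ Ω Ωω (fun m δ => if _ : δ < α then psi θ Ω Ωω m δ else 0) α n
  small_iUnion _

theorem psi_eq_sInf (θ : Ordinal.{u}) (Ω : ℕ → Ordinal.{u}) (Ωω : Ordinal.{u}) (n : ℕ)
    (α : Ordinal.{u}) : psi θ Ω Ωω n α = sInf (Bset θ Ω Ωω n α)ᶜ := by
  rw [psi]
  rfl

theorem psi_notMem_Bset (θ : Ordinal.{u}) (Ω : ℕ → Ordinal.{u}) (Ωω : Ordinal.{u}) (n : ℕ)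
    (α : Ordinal.{u}) : psi θ Ω Ωω n α ∉ Bset θ Ω Ωω n α := by
  have hne : (Bset θ Ω Ωω n α)ᶜ.Nonempty := by
    have := small_Bset θ Ω Ωω n α
    obtain ⟨b, hb⟩ := Ordinal.bddAbove_of_small (s := Bset θ Ω Ωω n α)
    exact ⟨Order.succ b, fun h => (Order.lt_succ b).not_ge (hb h)⟩
  rw [psi_eq_sInf]
  exact csInf_mem hne

theorem mem_Bset_of_lt_psi {γ : Ordinal.{u}} (h : γ < psi θ Ω Ωω n α) : γ ∈ Bset θ Ω Ωω n α := by
  rw [psi_eq_sInf] at h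
  exact not_not.1 (notMem_of_lt_csInf' h)

theorem Bset_mono (h : β ≤ α) : Bset θ Ω Ωω n β ⊆ Bset θ Ω Ωω n α := by
  refine iUnion_mono fun k => ?_
  induction k with
  | zero => exact subset_rfl
  | succ k ih =>
    rintro x (((hx | ⟨δ, hδ, δ', hδ', rfl⟩) | ⟨δ, hδ, δ', hδ', rfl⟩) | ⟨m, δ, hδ, hlt, rfl⟩)
    · exact .inl (.inl (.inl (ih hx)))
    · exact .inl (.inl (.inr ⟨δ, ih hδ, δ', ih hδ', rfl⟩))
    · exact .inl (.inr ⟨δ, ih hδ, δ', ih hδ', rfl⟩)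
    · exact .inr ⟨m, δ, ih hδ, hlt.trans_le h, by simp [hlt, hlt.trans_le h]⟩

theorem psi_mem_Bset {m : ℕ} (hβ : β ∈ Bset θ Ω Ωω n α) (h : β < α) :
    psi θ Ω Ωω m β ∈ Bset θ Ω Ωω n α := by
  obtain ⟨k, hk⟩ := mem_iUnion.1 hβ
  exact mem_iUnion.2 ⟨k + 1, .inr ⟨m, β, hk, h, by simp [h]⟩⟩

end

/-- If `β ∈ B_n(α)` and `β < α`, then `ψ_n(β) < ψ_n(α)`. -/
theorem psi_strictMono (θ : Ordinal) (Ω : ℕ → Ordinal) (Ωω : Ordinal)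
    (hΩreg : ∀ n : ℕ, IsUncountableRegular (Ω n)) (hΩωreg : IsUncountableRegular Ωω)
    (hΩmono : ∀ n : ℕ, Ω n < Ω (n + 1)) (hΩltω : ∀ n : ℕ, Ω n < Ωω)
    (hθ : θ < Ω 0)
    (n : ℕ) (α β : Ordinal) (hmem : β ∈ Bset θ Ω Ωω n α) (hlt : β < α) :
    psi θ Ω Ωω n β < psi θ Ω Ωω n α := by
  refine lt_of_not_ge fun hle => psi_notMem_Bset θ Ω Ωω n α ?_
  rcases hle.lt_or_eq with h | h
  · exact Bset_mono hlt.le (mem_Bset_of_lt_psi h)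
  · exact h ▸ psi_mem_Bset hmem hlt
end

section
/- For every ordinal β, the intersection ⋂{B_n(α) : n < ω and β < α} equals B_0(β + 1). -/
open Ordinal Set

theorem phi_eq_veblen (α : Ordinal) : phi α = veblen α := by
  induction α using WellFoundedLT.induction with
  | ind α ih =>
    rw [phi, ← enumOrd_range (veblen_right_strictMono α)]
    congr 1
    ext β
    have hfix : (∀ δ, δ < α → phi δ β = β) ↔ ∀ δ < α, veblen δ β = β :=
      forall₂_congr fun δ hδ => by rw [ih δ hδ]
    rw [mem_ofPred_eq, hfix]
    obtain rfl | hα := eq_or_ne α 0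
    · have h := isPrincipal_add_iff_zero_or_omega0_opow (o := β)
      rw [veblen_zero]
      constructor
      · rintro ⟨hβ, -⟩
        obtain ⟨hβ, hadd⟩ := hβ rfl
        exact (h.1 fun γ δ hγ hδ => hadd γ hγ δ hδ).resolve_left hβ
      · intro hβ
        refine ⟨fun _ => ⟨?_, fun γ hγ δ hδ => h.2 (Or.inr hβ) hγ hδ⟩, by simp⟩
        obtain ⟨γ, rfl⟩ := hβ
        exact (opow_pos γ omega0_pos).ne'
    · rw [mem_range_veblen hα]
      simp [hα]

theorem enumOrd_lt_ord_of_isRegular {κ : Cardinal} (hκ : κ.IsRegular) {s : Set Ordinal}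
    (hs : ∀ x < κ.ord, ∃ c ∈ s, x ≤ c ∧ c < κ.ord) {a : Ordinal} (ha : a < κ.ord) :
    enumOrd s a < κ.ord := by
  induction a using WellFoundedLT.induction with
  | ind a ih =>
    have hsup : (⨆ b : Iio a, (enumOrd s b + 1)) < κ.ord := by
      refine lift_iSup_add_one_lt_of_lt_cof ?_ fun b => ih b b.2 (b.2.trans ha)
      rw [← lift_cof, hκ.cof_ord, Cardinal.mk_Iio_ordinal, Cardinal.lift_lift,
        Cardinal.lift_lt]
      exact Cardinal.lt_ord.1 ha
    obtain ⟨c, hc, hle, hlt⟩ := hs _ hsup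
    refine (enumOrd_le_of_forall_lt hc fun b hb => ?_).trans_lt hlt
    exact (Order.lt_add_one_iff.2 le_rfl).trans_le
      ((Ordinal.le_iSup (fun b : Iio a => enumOrd s b + 1) ⟨b, hb⟩).trans hle)

theorem veblen_lt_ord_of_isRegular {κ : Cardinal} (hκ : κ.IsRegular) (hκ' : Cardinal.aleph0 < κ)
    {a b : Ordinal} (ha : a < κ.ord) (hb : b < κ.ord) : veblen a b < κ.ord := by
  induction a using WellFoundedLT.induction generalizing b with
  | ind a ih =>
    obtain rfl | ha0 := eq_or_ne a 0
    · rw [veblen_zero]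
      exact isPrincipal_opow_ord hκ.aleph0_le
        (Cardinal.ord_aleph0 ▸ Cardinal.ord_lt_ord.2 hκ') hb
    · rw [← enumOrd_range (veblen_right_strictMono a)]
      refine enumOrd_lt_ord_of_isRegular hκ (fun x hx => ?_) hb
      let f : a.ToType → Ordinal → Ordinal := fun i => veblen (ToType.mk.symm i)
      refine ⟨nfpFamily f x, (mem_range_veblen ha0).2 fun d hd => ?_, le_nfpFamily f x, ?_⟩
      · simpa [f] using nfpFamily_fp (f := f) (i := ToType.mk ⟨d, hd⟩) (isNormal_veblen _) x
      · refine Cardinal.nfpFamily_lt_ord_of_isRegular hκ ?_ hκ'.ne' (fun i y hy => ?_) hx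
        · simpa [Cardinal.lt_ord] using ha
        · have hi := (ToType.mk.symm i).2
          exact ih _ hi (hi.trans ha) hy

theorem stronglyCritical_nfp_veblen (x : Ordinal) :
    StronglyCritical (nfp (fun y => veblen y y) x) := by
  have hlt : ∀ n, (fun y => veblen y y)^[n] x < nfp (fun y => veblen y y) x := fun n =>
    (lt_veblen _).trans_le (by
      simpa only [Function.iterate_succ_apply'] using
        iterate_le_nfp (fun y => veblen y y) x (n + 1))
  refine ⟨(zero_le.trans_lt (hlt 0)).ne', fun δ hδ γ hγ => ?_⟩
  obtain ⟨m, hm⟩ := lt_nfp_iff.1 hδ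
  obtain ⟨n, hn⟩ := lt_nfp_iff.1 hγ
  have hmono : Monotone fun n => (fun y => veblen y y)^[n] x :=
    monotone_nat_of_le_succ fun n => by
      simpa only [Function.iterate_succ_apply'] using (lt_veblen _).le
  have hm' := hm.le.trans (hmono (le_max_left m n))
  have hn' := hn.le.trans (hmono (le_max_right m n))
  have hmax := hlt (max m n + 1)
  rw [Function.iterate_succ_apply'] at hmax
  rw [phi_eq_veblen]
  exact ((veblen_left_monotone _ hm').trans
    ((veblen_right_strictMono _).monotone hn')).trans_lt hmax

theorem Gamma_lt_ord_of_isRegular {κ : Cardinal} (hκ : κ.IsRegular) (hκ' : Cardinal.aleph0 < κ)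
    {a : Ordinal} (ha : a < κ.ord) : Gamma a < κ.ord :=
  enumOrd_lt_ord_of_isRegular hκ (fun x hx => ⟨_, stronglyCritical_nfp_veblen x, le_nfp _ x,
    Cardinal.nfp_lt_ord_of_isRegular hκ hκ'.ne'
      (fun _ hy => veblen_lt_ord_of_isRegular hκ hκ' hy hy) hx⟩) ha

theorem Biter_subset {θ : Ordinal} {Ω : ℕ → Ordinal} {Ωω : Ordinal}
    {f g : ℕ → Ordinal → Ordinal} {α α' : Ordinal} {n n' : ℕ} (hα : α ≤ α')
    (hfg : ∀ m, ∀ δ < α, f m δ = g m δ) (hbase : Bbase θ Ω Ωω n ⊆ Bbase θ Ω Ωω n') (k : ℕ) :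
    Biter θ Ω Ωω f α n k ⊆ Biter θ Ω Ωω g α' n' k := by
  induction k with
  | zero => exact hbase
  | succ k ih =>
    rintro x (((hx | ⟨δ, hδ, δ', hδ', rfl⟩) | ⟨δ, hδ, δ', hδ', rfl⟩) | ⟨m, δ, hδ, hlt, rfl⟩)
    · exact Or.inl (Or.inl (Or.inl (ih hx)))
    · exact Or.inl (Or.inl (Or.inr ⟨δ, ih hδ, δ', ih hδ', rfl⟩))
    · exact Or.inl (Or.inr ⟨δ, ih hδ, δ', ih hδ', rfl⟩)
    · exact Or.inr ⟨m, δ, ih hδ, hlt.trans_le hα, hfg m δ hlt⟩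

theorem Bset_subset {θ : Ordinal} {Ω : ℕ → Ordinal} {Ωω : Ordinal} {α α' : Ordinal} {n n' : ℕ}
    (hα : α ≤ α') (hbase : Bbase θ Ω Ωω n ⊆ Bbase θ Ω Ωω n') :
    Bset θ Ω Ωω n α ⊆ Bset θ Ω Ωω n' α' :=
  iUnion_mono fun k => Biter_subset hα
    (fun m δ hδ => by rw [dif_pos hδ, dif_pos (hδ.trans_le hα)]) hbase k

theorem Bbase_zero_subset {θ : Ordinal} {Ω : ℕ → Ordinal} {Ωω : Ordinal}
    (hΩreg : ∀ n, IsUncountableRegular (Ω n)) (hΩmono : StrictMono Ω) (hθ : θ < Ω 0) (n : ℕ) :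
    Bbase θ Ω Ωω 0 ⊆ Bbase θ Ω Ωω n := by
  cases n with
  | zero => exact Subset.rfl
  | succ n =>
    have hθn : θ < Ω n := hθ.trans_le (hΩmono.monotone n.zero_le)
    rintro x ((rfl | ⟨γ, hγ, rfl⟩) | hx)
    · exact Or.inl (zero_le.trans_lt hθn)
    · obtain ⟨κ, hκ', hκ, hΩn⟩ := hΩreg n
      refine Or.inl ?_
      rw [mem_ofPred_eq, hΩn]
      exact Gamma_lt_ord_of_isRegular hκ hκ' (hΩn ▸ hγ.trans_lt hθn)
    · exact Or.inr hx

/-- For every ordinal `β`, `⋂ {B_n(α) : n < ω, β < α} = B_0(β + 1)`. -/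
theorem iInter_Bset (θ : Ordinal) (Ω : ℕ → Ordinal) (Ωω : Ordinal)
    (hΩreg : ∀ n : ℕ, IsUncountableRegular (Ω n)) (hΩωreg : IsUncountableRegular Ωω)
    (hΩmono : ∀ n : ℕ, Ω n < Ω (n + 1)) (hΩltω : ∀ n : ℕ, Ω n < Ωω)
    (hθ : θ < Ω 0)
    (β : Ordinal) :
    (⋂ (n : ℕ), ⋂ (α : Ordinal), ⋂ (_ : β < α), Bset θ Ω Ωω n α) =
      Bset θ Ω Ωω 0 (β + 1) := by
  refine Subset.antisymm (fun x hx => ?_) ?_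
  · simp only [mem_iInter] at hx
    exact hx 0 _ (Order.lt_add_one_iff.2 le_rfl)
  · refine subset_iInter fun n => subset_iInter fun α => subset_iInter fun hα => ?_
    exact Bset_subset (Order.add_one_le_of_lt hα)
      (Bbase_zero_subset hΩreg (strictMono_nat_of_lt_succ hΩmono) hθ n)
end
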